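/- Let T > 0, let (Ω, F, P) be a probability space, and let f, g : [0,T] → ℝ be bounded measurable (deterministic) functions. Let U and V be real random variables on Ω such that the law of U is the centered Gaussian measure with variance ‖f‖₂², the law of V is the centered Gaussian measure with variance ‖g‖₂², and the law of U − V is the centered Gaussian measure with variance ‖f − g‖₂². Then for any q ≥ 1 and any q₁, q₂ ≥ 1 with 1/q₁ + 1/q₂ = 1/q, one has E[ | e^{U − ‖f‖₂²/2} − e^{V − ‖g‖₂²/2} |^q ]^{1/q} ≤ ( e^{(q₁−1)T‖f‖_∞²/2} + e^{(q₁−1)T‖g‖_∞²/2} ) · ( κ(q₂) + (√T/2)(‖f‖_∞ + ‖g‖_∞) ) · ‖f − g‖₂. -/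

import Mathlib

open MeasureTheory ProbabilityTheory

/-- The `L²([0,T])` norm of a function. -/
noncomputable def l2Norm (T : ℝ) (l : ℝ → ℝ) : ℝ :=
  Real.sqrt (∫ s in Set.Icc (0 : ℝ) T, (l s) ^ 2)

/-- The `L^∞([0,T])` (essential supremum) norm of a function. -/
noncomputable def linfNorm (T : ℝ) (l : ℝ → ℝ) : ℝ :=
  essSup (fun s => |l s|) (MeasureTheory.volume.restrict (Set.Icc (0 : ℝ) T))

/-- The normalized `q`-th absolute moment of a standard Gaussian random variable. -/
noncomputable def kappa (q : ℝ) : ℝ :=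
  Real.sqrt 2 * (Real.Gamma ((q + 1) / 2) / Real.sqrt Real.pi) ^ (1 / q)

lemma abs_exp_sub_exp_le (x y : ℝ) :
    |Real.exp x - Real.exp y| ≤ (Real.exp x + Real.exp y) * |x - y| := by
  wlog h : y ≤ x generalizing x y
  · rw [abs_sub_comm, abs_sub_comm x y, add_comm]
    exact this y x (le_of_not_ge h)
  rw [abs_of_nonneg (sub_nonneg.2 (Real.exp_le_exp.2 h)), abs_of_nonneg (sub_nonneg.2 h)]
  have h1 : Real.exp x * Real.exp (y - x) = Real.exp y := by
    rw [← Real.exp_add]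
    congr 1
    ring
  nlinarith [Real.add_one_le_exp (y - x), Real.exp_pos x, Real.exp_pos y]

lemma kappa_nonneg {p : ℝ} (hp : 0 < p) : 0 ≤ kappa p := by
  have := Real.Gamma_pos_of_pos (s := (p + 1) / 2) (by linarith)
  unfold kappa
  positivity

lemma integral_abs_rpow_gaussianReal_zero_one {p : ℝ} (hp : 0 < p) :
    ∫ x, |x| ^ p ∂(gaussianReal 0 1) = kappa p ^ p := by
  have hG := Real.Gamma_pos_of_pos (s := (p + 1) / 2) (by linarith)
  rw [integral_gaussianReal_eq_integral_smul one_ne_zero]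
  have h1 : ∀ x : ℝ, gaussianPDFReal 0 1 x • |x| ^ p =
      (fun y : ℝ => (Real.sqrt (2 * Real.pi))⁻¹ *
        (y ^ p * Real.exp (-(1 / 2) * y ^ (2 : ℝ)))) |x| := by
    intro x
    simp only [gaussianPDFReal, smul_eq_mul, Real.rpow_two, sq_abs]
    rw [mul_assoc, mul_comm (Real.exp _)]
    congr 3
    · simp
    · simp only [NNReal.coe_one]
      ring
  rw [integral_congr_ae (Filter.Eventually.of_forall h1),
    integral_comp_abs (f := fun y : ℝ => (Real.sqrt (2 * Real.pi))⁻¹ *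
      (y ^ p * Real.exp (-(1 / 2) * y ^ (2 : ℝ)))), integral_const_mul,
    integral_rpow_mul_exp_neg_mul_rpow two_pos (by linarith) (by norm_num)]
  have h2 : (1 / 2 : ℝ) ^ (-(p + 1) / 2) = Real.sqrt 2 * Real.sqrt 2 ^ p := by
    rw [one_div, Real.inv_rpow zero_le_two, ← Real.rpow_neg zero_le_two, Real.sqrt_eq_rpow,
      ← Real.rpow_mul zero_le_two, ← Real.rpow_add two_pos]
    congr 1
    ring
  rw [h2, kappa, Real.mul_rpow (by positivity) (by positivity), ← Real.rpow_mul (by positivity),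
    one_div_mul_cancel hp.ne', Real.rpow_one, Real.sqrt_mul zero_le_two]
  field_simp

lemma eLpNorm_id_gaussianReal_zero {p : ℝ} (hp : 0 < p) (v : NNReal) :
    eLpNorm id (ENNReal.ofReal p) (gaussianReal 0 v) =
      ENNReal.ofReal (kappa p * Real.sqrt v) := by
  have hstd : eLpNorm id (ENNReal.ofReal p) (gaussianReal 0 1) = ENNReal.ofReal (kappa p) := by
    rw [(memLp_id_gaussianReal' _ ENNReal.ofReal_ne_top).eLpNorm_eq_integral_rpow_norm
      (by simpa using hp) ENNReal.ofReal_ne_top, ENNReal.toReal_ofReal hp.le]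
    simp only [id, Real.norm_eq_abs]
    rw [integral_abs_rpow_gaussianReal_zero_one hp,
      Real.rpow_rpow_inv (kappa_nonneg hp) hp.ne']
  have hmap : (gaussianReal 0 1).map (Real.sqrt v * ·) = gaussianReal 0 v := by
    rw [gaussianReal_map_const_mul]
    congr 1
    · simp
    · ext
      simp
  rw [← hmap, eLpNorm_map_measure aestronglyMeasurable_id (by fun_prop)]
  have hcomp : id ∘ (Real.sqrt v * ·) = Real.sqrt v • (id : ℝ → ℝ) := by
    ext
    simp
  rw [hcomp, eLpNorm_const_smul, hstd, Real.enorm_eq_ofReal (Real.sqrt_nonneg _),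
    ← ENNReal.ofReal_mul (Real.sqrt_nonneg _), mul_comm]

lemma eLpNorm_exp_of_map_eq_gaussianReal {Ω : Type*} [MeasurableSpace Ω] {P : Measure Ω}
    [IsProbabilityMeasure P] {X : Ω → ℝ} (hX : Measurable X) {v : NNReal}
    (hlaw : P.map X = gaussianReal 0 v) {p : ℝ} (hp : 0 < p) :
    eLpNorm (fun ω => Real.exp (X ω - v / 2)) (ENNReal.ofReal p) P =
      ENNReal.ofReal (Real.exp ((p - 1) * v / 2)) := by
  have hpow : ∀ ω, ‖Real.exp (X ω - v / 2)‖ ^ p =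
      Real.exp (-(p * v / 2)) * Real.exp (p * X ω) := by
    intro ω
    rw [Real.norm_of_nonneg (Real.exp_pos _).le, ← Real.exp_mul, ← Real.exp_add]
    congr 1
    ring
  have hint : Integrable (fun ω => Real.exp (p * X ω)) P := by
    have h := integrable_exp_mul_gaussianReal (μ := 0) (v := v) p
    rw [← hlaw] at h
    exact h.comp_measurable hX
  have hmem : MemLp (fun ω => Real.exp (X ω - v / 2)) (ENNReal.ofReal p) P := by
    rw [← integrable_norm_rpow_iff (by fun_prop) (by simpa using hp) ENNReal.ofReal_ne_top,
      ENNReal.toReal_ofReal hp.le]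
    simp_rw [hpow]
    exact hint.const_mul _
  have hmgf := mgf_gaussianReal hlaw p
  rw [mgf] at hmgf
  rw [hmem.eLpNorm_eq_integral_rpow_norm (by simpa using hp) ENNReal.ofReal_ne_top,
    ENNReal.toReal_ofReal hp.le]
  simp_rw [hpow]
  rw [integral_const_mul, hmgf, ← Real.exp_add, ← Real.exp_mul]
  congr 2
  field_simp
  ring

section DeterministicNorms

variable {T : ℝ} {f g : ℝ → ℝ}

lemma l2Norm_nonneg (T : ℝ) (f : ℝ → ℝ) : 0 ≤ l2Norm T f := Real.sqrt_nonneg _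

lemma l2Norm_sq (T : ℝ) (f : ℝ → ℝ) :
    l2Norm T f ^ 2 = ∫ s in Set.Icc (0 : ℝ) T, f s ^ 2 :=
  Real.sq_sqrt (integral_nonneg fun _ => sq_nonneg _)

lemma ae_abs_le_linfNorm (hf : ∃ C : ℝ, ∀ s ∈ Set.Icc (0 : ℝ) T, |f s| ≤ C) :
    ∀ᵐ s ∂(volume.restrict (Set.Icc (0 : ℝ) T)), |f s| ≤ linfNorm T f := by
  obtain ⟨C, hC⟩ := hf
  exact ae_le_essSup ⟨C, Filter.eventually_map.2
    ((ae_restrict_iff' measurableSet_Icc).2 (Filter.Eventually.of_forall hC))⟩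

lemma linfNorm_nonneg (hT : 0 < T) (hf : ∃ C : ℝ, ∀ s ∈ Set.Icc (0 : ℝ) T, |f s| ≤ C) :
    0 ≤ linfNorm T f := by
  have : NeZero (volume.restrict (Set.Icc (0 : ℝ) T)) := ⟨by
    simpa [Measure.restrict_eq_zero] using hT⟩
  obtain ⟨s, hs⟩ := (ae_abs_le_linfNorm hf).exists
  exact (abs_nonneg _).trans hs

lemma memLp_top_restrict_Icc (hfm : Measurable f)
    (hf : ∃ C : ℝ, ∀ s ∈ Set.Icc (0 : ℝ) T, |f s| ≤ C) :
    MemLp f ⊤ (volume.restrict (Set.Icc (0 : ℝ) T)) :=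
  memLp_top_of_bound hfm.aestronglyMeasurable _ (ae_abs_le_linfNorm hf)

lemma l2Norm_sq_le (hT : 0 < T) (hfm : Measurable f)
    (hf : ∃ C : ℝ, ∀ s ∈ Set.Icc (0 : ℝ) T, |f s| ≤ C) :
    l2Norm T f ^ 2 ≤ T * linfNorm T f ^ 2 := by
  rw [l2Norm_sq]
  calc ∫ s in Set.Icc (0 : ℝ) T, f s ^ 2
      ≤ ∫ _ in Set.Icc (0 : ℝ) T, linfNorm T f ^ 2 := by
        refine integral_mono_ae
          ((memLp_top_restrict_Icc hfm hf).mono_exponent le_top).integrable_sq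
          (integrable_const _) ?_
        filter_upwards [ae_abs_le_linfNorm hf] with s hs
        simpa using pow_le_pow_left₀ (abs_nonneg _) hs 2
    _ = T * linfNorm T f ^ 2 := by simp [hT.le]

lemma integral_abs_le_sqrt_mul_l2Norm (hT : 0 < T) (hfm : Measurable f)
    (hf : ∃ C : ℝ, ∀ s ∈ Set.Icc (0 : ℝ) T, |f s| ≤ C) :
    ∫ s in Set.Icc (0 : ℝ) T, |f s| ≤ Real.sqrt T * l2Norm T f := by
  have hint : Integrable f (volume.restrict (Set.Icc (0 : ℝ) T)) :=
    (memLp_top_restrict_Icc hfm hf).integrable le_top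
  have hsq : Integrable (fun s => f s ^ 2) (volume.restrict (Set.Icc (0 : ℝ) T)) :=
    ((memLp_top_restrict_Icc hfm hf).mono_exponent le_top).integrable_sq
  set I := ∫ s in Set.Icc (0 : ℝ) T, |f s| with hI
  have h0 : 0 ≤ ∫ s in Set.Icc (0 : ℝ) T, (T * |f s| - I) ^ 2 :=
    integral_nonneg fun _ => sq_nonneg _
  have h1 : ∀ s, (T * |f s| - I) ^ 2 = T ^ 2 * f s ^ 2 - 2 * T * I * |f s| + I ^ 2 := by
    intro s
    rw [← sq_abs (f s)]
    ring
  simp_rw [h1] at h0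
  have h2 : Integrable (fun s => T ^ 2 * f s ^ 2 - 2 * T * I * |f s|)
      (volume.restrict (Set.Icc (0 : ℝ) T)) := (hsq.const_mul _).sub (hint.abs.const_mul _)
  rw [integral_add h2 (integrable_const _),
    integral_sub (hsq.const_mul _) (hint.abs.const_mul _), integral_const_mul,
    integral_const_mul, ← hI, ← l2Norm_sq] at h0
  simp only [integral_const, MeasurableSet.univ, measureReal_restrict_apply, Set.univ_inter,
    Real.volume_real_Icc, sub_zero, max_eq_left hT.le, smul_eq_mul] at h0
  have h3 : I ^ 2 ≤ T * l2Norm T f ^ 2 := by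
    refine le_of_mul_le_mul_left ?_ hT
    linarith
  refine le_of_sq_le_sq ?_ (mul_nonneg (Real.sqrt_nonneg _) (l2Norm_nonneg _ _))
  rwa [mul_pow, Real.sq_sqrt hT.le]

lemma abs_l2Norm_sq_sub_le (hT : 0 < T) (hfm : Measurable f) (hgm : Measurable g)
    (hf : ∃ C : ℝ, ∀ s ∈ Set.Icc (0 : ℝ) T, |f s| ≤ C)
    (hg : ∃ C : ℝ, ∀ s ∈ Set.Icc (0 : ℝ) T, |g s| ≤ C) :
    |l2Norm T f ^ 2 - l2Norm T g ^ 2| ≤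
      Real.sqrt T * (linfNorm T f + linfNorm T g) * l2Norm T (fun s => f s - g s) := by
  have hfL := memLp_top_restrict_Icc hfm hf
  have hgL := memLp_top_restrict_Icc hgm hg
  have hfg : ∃ C : ℝ, ∀ s ∈ Set.Icc (0 : ℝ) T, |f s - g s| ≤ C := by
    obtain ⟨C, hC⟩ := hf
    obtain ⟨D, hD⟩ := hg
    exact ⟨C + D, fun s hs => (abs_sub _ _).trans (add_le_add (hC s hs) (hD s hs))⟩
  rw [l2Norm_sq, l2Norm_sq, ← integral_sub (hfL.mono_exponent le_top).integrable_sq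
    (hgL.mono_exponent le_top).integrable_sq]
  calc |∫ s in Set.Icc (0 : ℝ) T, (f s ^ 2 - g s ^ 2)|
      ≤ ∫ s in Set.Icc (0 : ℝ) T, (linfNorm T f + linfNorm T g) * |f s - g s| := by
        refine norm_integral_le_of_norm_le (f := fun s => f s ^ 2 - g s ^ 2)
          (((hfL.integrable le_top).sub (hgL.integrable le_top)).abs.const_mul _) ?_
        filter_upwards [ae_abs_le_linfNorm hf, ae_abs_le_linfNorm hg] with s hs ht
        rw [Real.norm_eq_abs, sq_sub_sq, abs_mul]
        gcongr
        exact (abs_add_le _ _).trans (add_le_add hs ht)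
    _ ≤ (linfNorm T f + linfNorm T g) * (Real.sqrt T * l2Norm T (fun s => f s - g s)) := by
        rw [integral_const_mul]
        exact mul_le_mul_of_nonneg_left
          (integral_abs_le_sqrt_mul_l2Norm hT (hfm.sub hgm) hfg)
          (add_nonneg (linfNorm_nonneg hT hf) (linfNorm_nonneg hT hg))
    _ = _ := by ring

lemma eLpNorm_exp_le_of_map_eq_gaussianReal {Ω : Type*} [MeasurableSpace Ω] {P : Measure Ω}
    [IsProbabilityMeasure P] {X : Ω → ℝ} (hX : Measurable X) (hT : 0 < T) (hfm : Measurable f)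
    (hf : ∃ C : ℝ, ∀ s ∈ Set.Icc (0 : ℝ) T, |f s| ≤ C)
    (hlaw : P.map X = gaussianReal 0 ((l2Norm T f ^ 2).toNNReal)) {p : ℝ} (hp : 1 ≤ p) :
    eLpNorm (fun ω => Real.exp (X ω - l2Norm T f ^ 2 / 2)) (ENNReal.ofReal p) P ≤
      ENNReal.ofReal (Real.exp ((p - 1) * T * linfNorm T f ^ 2 / 2)) := by
  have h := eLpNorm_exp_of_map_eq_gaussianReal hX hlaw (zero_lt_one.trans_le hp)
  rw [Real.coe_toNNReal _ (sq_nonneg _)] at h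
  rw [h, mul_assoc]
  have := l2Norm_sq_le hT hfm hf
  gcongr

end DeterministicNorms

theorem lemma_two_one
    (T : ℝ) (hT : 0 < T) (f g : ℝ → ℝ)
    (hf : Measurable f) (hg : Measurable g)
    (hfB : ∃ C : ℝ, ∀ s ∈ Set.Icc (0 : ℝ) T, |f s| ≤ C)
    (hgB : ∃ C : ℝ, ∀ s ∈ Set.Icc (0 : ℝ) T, |g s| ≤ C)
    {Ω : Type*} [MeasurableSpace Ω] (P : Measure Ω) [IsProbabilityMeasure P]
    (U V : Ω → ℝ) (hU : Measurable U) (hV : Measurable V)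
    (hUlaw : Measure.map U P = gaussianReal 0 ((l2Norm T f ^ 2).toNNReal))
    (hVlaw : Measure.map V P = gaussianReal 0 ((l2Norm T g ^ 2).toNNReal))
    (hUVlaw : Measure.map (fun ω => U ω - V ω) P =
      gaussianReal 0 ((l2Norm T (fun s => f s - g s) ^ 2).toNNReal))
    (q q₁ q₂ : ℝ) (hq : 1 ≤ q) (hq₁ : 1 ≤ q₁) (hq₂ : 1 ≤ q₂)
    (hqq : 1 / q₁ + 1 / q₂ = 1 / q) :
    (∫ ω, |Real.exp (U ω - l2Norm T f ^ 2 / 2) -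
        Real.exp (V ω - l2Norm T g ^ 2 / 2)| ^ q ∂P) ^ (1 / q) ≤
      (Real.exp ((q₁ - 1) * T * linfNorm T f ^ 2 / 2) +
          Real.exp ((q₁ - 1) * T * linfNorm T g ^ 2 / 2)) *
        (kappa q₂ + Real.sqrt T / 2 * (linfNorm T f + linfNorm T g)) *
        l2Norm T (fun s => f s - g s) := by
  have hq0 : 0 < q := by linarith
  have hq₁0 : 0 < q₁ := by linarith
  have hq₂0 : 0 < q₂ := by linarith
  have htriple : ENNReal.HolderTriple (ENNReal.ofReal q₁) (ENNReal.ofReal q₂)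
      (ENNReal.ofReal q) :=
    Real.HolderTriple.ennrealOfReal ⟨by simpa using hqq, hq₁0, hq₂0⟩
  set X : Ω → ℝ := fun ω => U ω - l2Norm T f ^ 2 / 2 with hX
  set Y : Ω → ℝ := fun ω => V ω - l2Norm T g ^ 2 / 2 with hY
  set d := l2Norm T (fun s => f s - g s) with hd
  have hd0 : 0 ≤ d := l2Norm_nonneg _ _
  have hXm : Measurable X := hU.sub_const _
  have hYm : Measurable Y := hV.sub_const _
  have hκ := kappa_nonneg hq₂0
  have hf0 := linfNorm_nonneg hT hfB
  have hg0 := linfNorm_nonneg hT hgB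
  have hexp : eLpNorm (fun ω => Real.exp (X ω) + Real.exp (Y ω)) (ENNReal.ofReal q₁) P ≤
      ENNReal.ofReal (Real.exp ((q₁ - 1) * T * linfNorm T f ^ 2 / 2) +
        Real.exp ((q₁ - 1) * T * linfNorm T g ^ 2 / 2)) := by
    rw [ENNReal.ofReal_add (Real.exp_pos _).le (Real.exp_pos _).le]
    exact (eLpNorm_add_le (by fun_prop) (by fun_prop) (by simpa using hq₁)).trans
      (add_le_add (eLpNorm_exp_le_of_map_eq_gaussianReal hU hT hf hfB hUlaw hq₁)
        (eLpNorm_exp_le_of_map_eq_gaussianReal hV hT hg hgB hVlaw hq₁))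
  have hUV : eLpNorm (fun ω => U ω - V ω) (ENNReal.ofReal q₂) P =
      ENNReal.ofReal (kappa q₂ * d) := by
    have h := eLpNorm_map_measure (p := ENNReal.ofReal q₂) (μ := P)
      (f := fun ω => U ω - V ω) (g := id) aestronglyMeasurable_id (by fun_prop)
    rw [hUVlaw, eLpNorm_id_gaussianReal_zero hq₂0, Real.coe_toNNReal _ (sq_nonneg _),
      Real.sqrt_sq hd0] at h
    exact h.symm
  have hdiff : eLpNorm (fun ω => X ω - Y ω) (ENNReal.ofReal q₂) P ≤
      ENNReal.ofReal ((kappa q₂ + Real.sqrt T / 2 * (linfNorm T f + linfNorm T g)) * d) := by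
    set c := (l2Norm T g ^ 2 - l2Norm T f ^ 2) / 2 with hc
    have hXY : (fun ω => X ω - Y ω) = (fun ω => U ω - V ω) + fun _ => c := by
      ext ω
      simp only [hX, hY, hc, Pi.add_apply]
      ring
    have hcle : |c| ≤ Real.sqrt T / 2 * (linfNorm T f + linfNorm T g) * d := by
      have h := abs_l2Norm_sq_sub_le hT hf hg hfB hgB
      rw [hc, abs_div, abs_sub_comm, abs_two]
      linarith
    rw [hXY, add_mul, ENNReal.ofReal_add (by positivity) (by positivity)]
    refine (eLpNorm_add_le (by fun_prop) (by fun_prop) (by simpa using hq₂)).trans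
      (add_le_add hUV.le ?_)
    rw [eLpNorm_const _ (by simpa using hq₂0) (IsProbabilityMeasure.ne_zero P), measure_univ,
      ENNReal.one_rpow, mul_one, ← ofReal_norm]
    exact ENNReal.ofReal_le_ofReal hcle
  have hmain : eLpNorm (fun ω => Real.exp (X ω) - Real.exp (Y ω)) (ENNReal.ofReal q) P ≤
      ENNReal.ofReal ((Real.exp ((q₁ - 1) * T * linfNorm T f ^ 2 / 2) +
          Real.exp ((q₁ - 1) * T * linfNorm T g ^ 2 / 2)) *
        (kappa q₂ + Real.sqrt T / 2 * (linfNorm T f + linfNorm T g)) * d) := by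
    rw [mul_assoc, ENNReal.ofReal_mul (by positivity)]
    calc eLpNorm (fun ω => Real.exp (X ω) - Real.exp (Y ω)) (ENNReal.ofReal q) P
        ≤ eLpNorm ((fun ω => Real.exp (X ω) + Real.exp (Y ω)) • fun ω => X ω - Y ω)
            (ENNReal.ofReal q) P := by
          refine eLpNorm_mono fun ω => ?_
          simp only [Pi.smul_apply', smul_eq_mul, norm_mul, Real.norm_eq_abs]
          rw [abs_of_pos (add_pos (Real.exp_pos (X ω)) (Real.exp_pos (Y ω)))]
          exact abs_exp_sub_exp_le _ _
      _ ≤ _ := eLpNorm_smul_le_mul_eLpNorm (by fun_prop) (by fun_prop)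
      _ ≤ _ := mul_le_mul' hexp hdiff
  have hmem : MemLp (fun ω => Real.exp (X ω) - Real.exp (Y ω)) (ENNReal.ofReal q) P :=
    ⟨by fun_prop, hmain.trans_lt ENNReal.ofReal_lt_top⟩
  rw [hmem.eLpNorm_eq_integral_rpow_norm (by simpa using hq0) ENNReal.ofReal_ne_top,
    ENNReal.toReal_ofReal hq0.le, ENNReal.ofReal_le_ofReal_iff (by positivity)] at hmain
  rw [one_div]
  exact hmain
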